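/- arXiv:math/0604369 — 2 statements merged into one kernel-verified Lean document; each statement's English description precedes it below -/
import Mathlib

section
/- Let U ⊂ ℝⁿ and V ⊂ ℝᵐ be compact convex sets, and let φ : U × V → ℝⁿ × ℝᵐ, φ(x,y) = (φ₁(x,y), φ₂(x,y)), be a continuous map such that ‖φ₁(x,y) − x‖ ≤ ρ₁ and ‖φ₂(x,y) − y‖ ≤ ρ₂ for some ρ₁, ρ₂ > 0 and all (x,y) ∈ U × V. Then every point (α,β) ∈ U × V with dist(α, ∂U) ≥ ρ₁ and dist(β, ∂V) ≥ ρ₂ lies in the image of φ. -/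
open Metric Set

open MeasureTheory in
lemma det_pos_aux {E : Type*} [NormedAddCommGroup E] [NormedSpace ℝ E] [FiniteDimensional ℝ E]
    (T : E →L[ℝ] E) (hT : ‖T‖ < 1) : 0 < (1 + T).det := by
  have hne : ∀ t ∈ Icc (0:ℝ) 1, (1 + t • T).det ≠ 0 := by
    intro t ht h0
    have hker := (LinearMap.bot_lt_ker_of_det_eq_zero (f := ((1 + t • T : E →L[ℝ] E) : E →ₗ[ℝ] E)) h0)
    obtain ⟨x, hx, hx0⟩ := (Submodule.ne_bot_iff _).1 hker.ne'
    have h1 : x + t • T x = 0 := by simpa using hx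
    have h2 : ‖x‖ = ‖t • T x‖ := by
      rw [← norm_neg (t • T x)]; exact congrArg norm (eq_neg_of_add_eq_zero_left h1)
    have h3 : ‖t • T x‖ ≤ ‖T x‖ := by
      rw [norm_smul, Real.norm_of_nonneg ht.1]
      exact mul_le_of_le_one_left (norm_nonneg _) ht.2
    have h4 := T.le_opNorm x
    have h5 : 0 < ‖x‖ := norm_pos_iff.2 hx0
    nlinarith
  have hc : Continuous (fun t : ℝ => (1 + t • T).det) := by
    have : Continuous (fun t : ℝ => (1 + t • T)) := by fun_prop
    exact ContinuousLinearMap.continuous_det.comp this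
  by_contra hneg
  push Not at hneg
  have := intermediate_value_Icc' (zero_le_one' ℝ) hc.continuousOn
  have h0 : (0:ℝ) ∈ Icc ((1 + (1:ℝ) • T).det) ((1 + (0:ℝ) • T).det) := by
    refine ⟨by simpa using hneg, ?_⟩
    simp [ContinuousLinearMap.det]
  obtain ⟨t, ht, h⟩ := this h0
  exact hne t ht h

lemma det_poly_aux {E : Type*} [NormedAddCommGroup E] [NormedSpace ℝ E] [FiniteDimensional ℝ E]
    (T : E →L[ℝ] E) : ∃ p : Polynomial ℝ, p.natDegree ≤ Module.finrank ℝ E ∧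
      ∀ t : ℝ, p.eval t = (1 + t • T).det := by
  let b := Module.finBasis ℝ E
  let A := LinearMap.toMatrix b b (T : E →ₗ[ℝ] E)
  refine ⟨Matrix.det ((Polynomial.X : Polynomial ℝ) • A.map Polynomial.C
    + (1 : Matrix _ _ ℝ).map Polynomial.C), ?_, ?_⟩
  · simpa using Polynomial.natDegree_det_X_add_C_le A 1
  · intro t
    rw [ContinuousLinearMap.det, ← LinearMap.det_toMatrix b,
      ← Polynomial.coe_evalRingHom, RingHom.map_det]
    congr 1
    ext i j
    simp [A, Matrix.one_apply, LinearMap.toMatrix_apply]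
    rcases eq_or_ne i j with rfl | hij
    · simp; ring
    · simp [hij, Finsupp.single_apply, hij.symm]; ring

lemma interp_aux (N : ℕ) (ε : ℝ) (hε : 0 < ε) : ∃ (t c : ℕ → ℝ),
    (∀ i ∈ Finset.range (N+1), 0 < t i ∧ t i ≤ ε) ∧ ∀ p : Polynomial ℝ, p.natDegree ≤ N →
      p.eval 1 = ∑ i ∈ Finset.range (N+1), c i * p.eval (t i) := by
  classical
  let t : ℕ → ℝ := fun i => ε / (i + 1)
  have hinj : Set.InjOn t (Finset.range (N+1)) := by
    intro i _ j _ h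
    simp only [t] at h
    field_simp at h
    exact_mod_cast (by linarith : (i:ℝ) = j)
  refine ⟨t, fun i => (Lagrange.basis (Finset.range (N+1)) t i).eval 1, ?_, ?_⟩
  · intro i _
    refine ⟨by positivity, div_le_self hε.le (by simp)⟩
  · intro p hp
    have h := Lagrange.eq_interpolate (f := p) hinj (by
      rw [Finset.card_range]
      exact lt_of_le_of_lt Polynomial.degree_le_natDegree (by exact_mod_cast Nat.lt_succ_of_le hp))
    conv_lhs => rw [h]
    rw [Lagrange.interpolate_apply, Polynomial.eval_finsetSum]
    refine Finset.sum_congr rfl fun i _ => ?_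
    rw [Polynomial.eval_mul, Polynomial.eval_C, mul_comm]

open MeasureTheory in
lemma integral_aux {E : Type*} [NormedAddCommGroup E] [NormedSpace ℝ E] [FiniteDimensional ℝ E]
    [MeasurableSpace E] [BorelSpace E] (μ : Measure E) [μ.IsAddHaarMeasure]
    (h : E → E) (L : NNReal) (hL : LipschitzWith L h) (R : ℝ)
    (h0 : ∀ x, R ≤ ‖x‖ → h x = 0) (hd : ∀ x ∈ ball (0:E) R, DifferentiableAt ℝ h x)
    (t : ℝ) (ht : 0 < t) (htL : t * L < 1) :
    IntegrableOn (fun x => (1 + t • fderiv ℝ h x).det) (ball 0 R) μ ∧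
    ∫ x in ball 0 R, (1 + t • fderiv ℝ h x).det ∂μ = μ.real (ball 0 R) := by
  let g : E → E := fun x => x + t • h x
  have hK : ∀ y, ContractingWith (t.toNNReal * L) (fun x => y - t • h x) := by
    intro y
    have ht' : ((t.toNNReal : NNReal) : ℝ) = t := Real.coe_toNNReal t ht.le
    have hlt : t.toNNReal * L < 1 := by
      rw [← NNReal.coe_lt_coe]; push_cast; rwa [ht']
    refine ⟨hlt, LipschitzWith.of_dist_le_mul fun a b => ?_⟩
    rw [dist_eq_norm]
    have : y - t • h a - (y - t • h b) = - (t • (h a - h b)) := by rw [smul_sub]; abel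
    rw [this, norm_neg, norm_smul, Real.norm_of_nonneg ht.le, ← dist_eq_norm]
    have := hL.dist_le_mul a b
    push_cast
    rw [ht', mul_assoc]
    exact mul_le_mul_of_nonneg_left this ht.le
  have hsurj : Function.Surjective g := by
    intro y
    have := (hK y).fixedPoint_isFixedPt
    exact ⟨ContractingWith.fixedPoint _ (hK y), eq_sub_iff_add_eq.1 this.symm⟩
  have hinj : Function.Injective g := by
    intro a b hab
    have := (hK (g a)).fixedPoint_unique' (x := a) (y := b)
    apply this
    · simp [Function.IsFixedPt, g]
    · rw [hab]; simp [Function.IsFixedPt, g]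
  have hout : ∀ x, x ∉ ball (0:E) R → g x = x := by
    intro x hx
    simp only [mem_ball_zero_iff, not_lt] at hx
    simp [g, h0 x hx]
  have himg : g '' ball 0 R = ball 0 R := by
    ext y
    constructor
    · rintro ⟨x, hx, rfl⟩
      by_contra hc
      exact hc (by rwa [hinj (hout _ hc)])
    · intro hy
      obtain ⟨x, rfl⟩ := hsurj y
      refine ⟨x, ?_, rfl⟩
      by_contra hc
      rw [hout x hc] at hy
      exact hc hy
  have hder : ∀ x ∈ ball (0:E) R, HasFDerivWithinAt g (1 + t • fderiv ℝ h x) (ball 0 R) x := by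
    intro x hx
    have := ((hasFDerivAt_id x).add ((hd x hx).hasFDerivAt.const_smul t)).hasFDerivWithinAt
      (s := ball 0 R)
    exact this
  have hpos : ∀ x, |(1 + t • fderiv ℝ h x).det| = (1 + t • fderiv ℝ h x).det := by
    intro x
    refine abs_of_pos (det_pos_aux _ ?_)
    rw [norm_smul, Real.norm_of_nonneg ht.le]
    exact lt_of_le_of_lt (mul_le_mul_of_nonneg_left (norm_fderiv_le_of_lipschitz ℝ hL) ht.le) htL
  have hi := integral_image_eq_integral_abs_det_fderiv_smul μ measurableSet_ball hder
    hinj.injOn (fun _ => (1:ℝ))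
  have hj := integrableOn_image_iff_integrableOn_abs_det_fderiv_smul μ measurableSet_ball hder
    hinj.injOn (fun _ => (1:ℝ))
  rw [himg] at hi hj
  simp only [hpos, smul_eq_mul, mul_one] at hi hj
  refine ⟨hj.1 (by simp [integrableOn_const_iff, measure_ball_lt_top]), ?_⟩
  rw [← hi]
  simp

open MeasureTheory in
lemma core_aux {E : Type*} [NormedAddCommGroup E] [NormedSpace ℝ E] [FiniteDimensional ℝ E]
    (h : E → E) (L : NNReal) (hL : LipschitzWith L h) (R : ℝ) (hR : 0 < R)
    (h0 : ∀ x, R ≤ ‖x‖ → h x = 0) (hd : ∀ x ∈ ball (0:E) R, DifferentiableAt ℝ h x) :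
    ∃ x ∈ ball (0:E) R, (1 + fderiv ℝ h x).det ≠ 0 := by
  let _ : MeasurableSpace E := borel E
  have : BorelSpace E := ⟨rfl⟩
  let μ : Measure E := Measure.addHaar
  by_contra hcon
  push Not at hcon
  obtain ⟨t, c, ht, hp⟩ := interp_aux (Module.finrank ℝ E) (1 / (L + 1)) (by positivity)
  have hI : ∀ i ∈ Finset.range (Module.finrank ℝ E + 1), _ := fun i hi =>
    integral_aux μ h L hL R h0 hd (t i) (ht i hi).1 (by
      have h1 := (ht i hi).2
      have h2 : (0:ℝ) ≤ L := L.2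
      calc t i * L ≤ 1 / (L + 1) * L := by gcongr
        _ < 1 := by rw [div_mul_eq_mul_div, one_mul, div_lt_one (by positivity)]; linarith)
  have hsum : ∀ x, (1 + fderiv ℝ h x).det =
      ∑ i ∈ Finset.range (Module.finrank ℝ E + 1), c i * (1 + t i • fderiv ℝ h x).det := by
    intro x
    obtain ⟨p, hp1, hp2⟩ := det_poly_aux (fderiv ℝ h x)
    have := hp p hp1
    simpa [hp2] using this
  have h1 : ∫ x in ball 0 R, (1 + fderiv ℝ h x).det ∂μ = 0 := by
    rw [setIntegral_congr_fun measurableSet_ball (g := fun _ => (0:ℝ)) (fun x hx => hcon x hx)]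
    simp
  simp only [hsum] at h1
  rw [integral_finsetSum _ (fun i hi => (hI i hi).1.const_mul _)] at h1
  have h2 : ∑ i ∈ Finset.range (Module.finrank ℝ E + 1), c i = 1 := by
    have := hp 1 (by simp)
    simpa using this.symm
  rw [Finset.sum_congr rfl (fun i hi => by rw [integral_const_mul, (hI i hi).2]),
    ← Finset.sum_mul, h2, one_mul] at h1
  have : 0 < μ.real (ball (0:E) R) :=
    ENNReal.toReal_pos (measure_ball_pos μ 0 hR).ne' measure_ball_lt_top.ne
  exact this.ne' h1

lemma glue_aux {E : Type*} [NormedAddCommGroup E] [NormedSpace ℝ E]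
    (H : E → E) (L : NNReal) (R : ℝ) (hL : LipschitzOnWith L H (closedBall 0 R))
    (h0 : ∀ x, ‖x‖ = R → H x = 0) :
    ∃ h : E → E, LipschitzWith L h ∧ (∀ x, R ≤ ‖x‖ → h x = 0) ∧ ∀ x, ‖x‖ ≤ R → h x = H x := by
  classical
  let h : E → E := fun x => if ‖x‖ ≤ R then H x else 0
  have hin : ∀ x, ‖x‖ ≤ R → h x = H x := fun x hx => if_pos hx
  have hout : ∀ x, R ≤ ‖x‖ → h x = 0 := by
    intro x hx
    rcases hx.eq_or_lt with h1 | h1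
    · rw [hin x h1.ge, h0 x h1.symm]
    · exact if_neg (not_le.2 h1)
  have key : ∀ x y, ‖x‖ ≤ R → R ≤ ‖y‖ → dist (h x) (h y) ≤ L * dist x y := by
    intro x y hx hy
    have hc : ContinuousOn (fun s : ℝ => ‖AffineMap.lineMap x y s‖) (Icc 0 1) := by
      apply Continuous.continuousOn
      exact AffineMap.lineMap_continuous.norm
    obtain ⟨s, hs, hz⟩ := intermediate_value_Icc (zero_le_one' ℝ) hc
      (show R ∈ Icc _ _ from ⟨by simpa using hx, by simpa using hy⟩)
    simp only at hz
    set z : E := AffineMap.lineMap x y s with hzdef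
    rw [hout y hy, hin x hx, ← h0 z hz]
    refine (hL.dist_le_mul x (by simpa using hx) z (by simpa using hz.le)).trans ?_
    gcongr
    rw [hzdef, dist_left_lineMap, Real.norm_of_nonneg hs.1]
    exact mul_le_of_le_one_left dist_nonneg hs.2
  refine ⟨h, LipschitzWith.of_dist_le_mul fun x y => ?_, hout, hin⟩
  rcases le_total ‖x‖ R with hx | hx <;> rcases le_total ‖y‖ R with hy | hy
  · rw [hin x hx, hin y hy]
    exact hL.dist_le_mul x (by simpa using hx) y (by simpa using hy)
  · exact key x y hx hy
  · rw [dist_comm, dist_comm x y]; exact key y x hy hx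
  · rw [hout x hx, hout y hy, dist_self]; positivity

lemma smooth_aux {E : Type*} [NormedAddCommGroup E] [InnerProductSpace ℝ E] [FiniteDimensional ℝ E]
    (v : E → E) (hv : ContDiff ℝ 1 v) (R : ℝ) (hR : 0 < R)
    (hvR : ∀ x, R ≤ ‖x‖ → v x = x) : ∃ x, v x = 0 := by
  by_contra hcon
  push Not at hcon
  let r : E → E := fun x => (R * ‖v x‖⁻¹) • v x
  have hr : ContDiff ℝ 1 r := by
    refine ContDiff.smul (contDiff_const.mul (ContDiff.inv (hv.norm ℝ hcon) ?_)) hv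
    intro x; simpa using hcon x
  have hrn : ∀ x, ‖r x‖ = R := by
    intro x
    have : ‖v x‖ ≠ 0 := by simpa using hcon x
    simp only [r, norm_smul, norm_mul, norm_inv, norm_norm, Real.norm_of_nonneg hR.le]
    field_simp
  have hH : ContDiff ℝ 1 (fun x => r x - x) := hr.sub contDiff_id
  obtain ⟨L, hL⟩ := LocallyLipschitzOn.exists_lipschitzOnWith_of_compact
    (isCompact_closedBall (0:E) R) (hH.locallyLipschitz.locallyLipschitzOn (s := closedBall 0 R))
  obtain ⟨h, hhL, hh0, hhH⟩ := glue_aux (fun x => r x - x) L R hL (by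
    intro x hx
    simp only [r]
    rw [hvR x hx.ge, hx, mul_inv_cancel₀ hR.ne', one_smul, sub_self])
  have hder : ∀ x ∈ ball (0:E) R, HasFDerivAt h (fderiv ℝ r x - 1) x := by
    intro x hx
    have h1 : HasFDerivAt (fun x => r x - x) (fderiv ℝ r x - 1) x :=
      ((hr.differentiable (by norm_num)) x).hasFDerivAt.sub (hasFDerivAt_id x)
    refine h1.congr_of_eventuallyEq ?_
    filter_upwards [isOpen_ball.mem_nhds hx] with y hy
    exact hhH y (by simpa using (mem_ball.1 hy).le)
  obtain ⟨x, hx, hdet⟩ := core_aux h L hhL R hR hh0 (fun x hx => (hder x hx).differentiableAt)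
  rw [(hder x hx).fderiv, add_sub_cancel] at hdet
  have hD : HasFDerivAt r (fderiv ℝ r x) x :=
    ((hr.differentiable (by norm_num)) x).hasFDerivAt
  have horth : ∀ y, inner ℝ (r x) (fderiv ℝ r x y) = 0 := by
    intro y
    have h1 := hD.norm_sq
    have h2 : (fun x => ‖r x‖ ^ 2) = fun _ => R ^ 2 := by funext z; rw [hrn]
    rw [h2] at h1
    have h3 := h1.unique (hasFDerivAt_const _ _)
    have h4 := congrArg (fun T => T y) h3
    simpa using h4
  have hsurj : Function.Surjective (fderiv ℝ r x) := by
    have := LinearMap.equivOfDetNeZero (fderiv ℝ r x : E →ₗ[ℝ] E) hdet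
    exact (LinearMap.equivOfDetNeZero (fderiv ℝ r x : E →ₗ[ℝ] E) hdet).surjective
  obtain ⟨y, hy⟩ := hsurj (r x)
  have := horth y
  rw [hy, real_inner_self_eq_norm_sq, hrn] at this
  exact (pow_pos hR 2).ne' this

lemma brouwer_aux {E : Type*} [NormedAddCommGroup E] [InnerProductSpace ℝ E]
    [FiniteDimensional ℝ E] (f : E → E) (hf : Continuous f) (R : ℝ) (hR : 0 < R)
    (hfR : ∀ x, R ≤ ‖x‖ → f x = 0) : ∃ x, f x = x := by
  by_contra hcon
  push Not at hcon
  obtain ⟨x₀, -, hx₀⟩ := (isCompact_closedBall (0:E) R).exists_isMinOn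
    ⟨0, by simpa using hR.le⟩ (f := fun x => ‖x - f x‖) (by fun_prop)
  have hδ : 0 < ‖x₀ - f x₀‖ := norm_pos_iff.2 (sub_ne_zero.2 (hcon x₀).symm)
  obtain ⟨g, hg, hgf, hgs⟩ := hf.exists_contDiff_approx 1 (ε := fun _ => ‖x₀ - f x₀‖)
    continuous_const (fun _ => hδ)
  have hgR : ∀ x, R ≤ ‖x‖ → g x = 0 := by
    intro x hx
    by_contra hne
    exact hgs hne (hfR x hx)
  obtain ⟨x, hx⟩ := smooth_aux (fun x => x - g x) (contDiff_id.sub hg) R hR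
    (fun x hx => by simp [hgR x hx])
  have hx' : g x = x := (sub_eq_zero.1 hx).symm
  rcases le_total ‖x‖ R with h | h
  · have h1 := hx₀ (by simpa using h : x ∈ closedBall (0:E) R)
    have h2 := hgf x
    rw [hx', dist_eq_norm] at h2
    exact absurd h1 (not_le.2 h2)
  · have h1 := hgR x h
    rw [hx'] at h1
    rw [h1, norm_zero] at h
    linarith

lemma ball_aux {E : Type*} [NormedAddCommGroup E] [NormedSpace ℝ E]
    (U : Set E) (hU : IsClosed U) (ρ : ℝ) (hρ : 0 < ρ) (α : E) (hα : α ∈ U)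
    (hd : ρ ≤ infDist α (frontier U)) : closedBall α ρ ⊆ U := by
  have h1 : ball α ρ ⊆ U := by
    have hdis : Disjoint (ball α ρ) (frontier U) :=
      (disjoint_ball_infDist (x := α) (s := frontier U)).mono_left (ball_subset_ball hd)
    have hpre : IsPreconnected (ball α ρ) := (convex_ball α ρ).isPreconnected
    intro y hy
    by_contra hyU
    have hin : ∀ z ∈ ball α ρ, z ∈ U → z ∈ interior U := by
      intro z hz hzU
      by_contra hni
      exact hdis.le_bot ⟨hz, subset_closure hzU, hni⟩
    obtain ⟨z, -, hz1, hz2⟩ := hpre (interior U) Uᶜ isOpen_interior hU.isOpen_compl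
      (fun z hz => (em (z ∈ U)).imp (hin z hz) id)
      ⟨α, mem_ball_self hρ, hin α (mem_ball_self hρ) hα⟩ ⟨y, hy, hyU⟩
    exact hz2 (interior_subset hz1)
  rw [← closure_ball α hρ.ne']
  exact closure_minimal h1 hU

lemma proj_aux {E : Type*} [NormedAddCommGroup E] [NormedSpace ℝ E] (ρ : ℝ) (hρ : 0 < ρ) :
    ∃ π : E → E, Continuous π ∧ (∀ x, ‖π x‖ ≤ ρ) ∧ ∀ x, ‖x‖ ≤ ρ → π x = x := by
  refine ⟨fun x => (ρ / max ρ ‖x‖) • x, ?_, ?_, ?_⟩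
  · refine Continuous.smul (Continuous.div (by fun_prop) (by fun_prop) ?_) continuous_id
    intro x
    exact (lt_max_of_lt_left hρ).ne'
  · intro x
    have h : 0 < max ρ ‖x‖ := lt_max_of_lt_left hρ
    rw [norm_smul, Real.norm_of_nonneg (by positivity), div_mul_eq_mul_div, div_le_iff₀ h]
    gcongr
    exact le_max_right _ _
  · intro x hx
    simp only [max_eq_left hx, div_self hρ.ne', one_smul]

/-- A continuous map of a product of two balls to itself has a fixed point. -/
lemma brouwer_prod {A B : Type*} [NormedAddCommGroup A] [InnerProductSpace ℝ A]
    [FiniteDimensional ℝ A] [NormedAddCommGroup B] [InnerProductSpace ℝ B]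
    [FiniteDimensional ℝ B] (ρ₁ ρ₂ : ℝ) (hρ₁ : 0 < ρ₁) (hρ₂ : 0 < ρ₂)
    (F : A × B → A × B)
    (hF : ContinuousOn F (closedBall 0 ρ₁ ×ˢ closedBall 0 ρ₂))
    (hF1 : ∀ p ∈ closedBall (0:A) ρ₁ ×ˢ closedBall (0:B) ρ₂, ‖(F p).1‖ ≤ ρ₁)
    (hF2 : ∀ p ∈ closedBall (0:A) ρ₁ ×ˢ closedBall (0:B) ρ₂, ‖(F p).2‖ ≤ ρ₂) :
    ∃ p ∈ closedBall (0:A) ρ₁ ×ˢ closedBall (0:B) ρ₂, F p = p := by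
  obtain ⟨π₁, hc1, hb1, he1⟩ := proj_aux (E := A) ρ₁ hρ₁
  obtain ⟨π₂, hc2, hb2, he2⟩ := proj_aux (E := B) ρ₂ hρ₂
  let π : A × B → A × B := fun p => (π₁ p.1, π₂ p.2)
  have hπ : Continuous π := by fun_prop
  have hmem : ∀ p, π p ∈ closedBall (0:A) ρ₁ ×ˢ closedBall (0:B) ρ₂ := fun p =>
    ⟨by simpa [π] using hb1 p.1, by simpa [π] using hb2 p.2⟩
  let c : A × B → ℝ := fun p => max 0 (1 - ‖p - π p‖)
  have hc : Continuous c := by fun_prop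
  have hc0 : ∀ p, 0 ≤ c p := fun p => le_max_left _ _
  have hc1 : ∀ p, c p ≤ 1 := fun p => max_le zero_le_one (by simp)
  let G : A × B → A × B := fun p => c p • F (π p)
  have hG : Continuous G := hc.smul (hF.comp_continuous hπ hmem)
  have hG0 : ∀ p, ρ₁ + ρ₂ + 1 ≤ ‖p‖ → G p = 0 := by
    intro p hp
    have h1 : ‖π p‖ ≤ ρ₁ + ρ₂ := by
      rw [Prod.norm_def]
      exact max_le ((hb1 _).trans (by linarith)) ((hb2 _).trans (by linarith))
    have h2 := norm_sub_norm_le p (π p)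
    have : c p = 0 := max_eq_left (by linarith)
    simp [G, this]
  let e := WithLp.prodContinuousLinearEquiv 2 ℝ A B
  obtain ⟨x, hx⟩ := brouwer_aux (E := WithLp 2 (A × B)) (fun x => e.symm (G (e x)))
    (e.symm.continuous.comp (hG.comp e.continuous)) 
    ((‖(e.symm : A × B →L[ℝ] WithLp 2 (A × B))‖ + 1) * (ρ₁ + ρ₂ + 1)) (by positivity) (by
      intro x hx
      rw [hG0, map_zero]
      by_contra hlt
      push Not at hlt
      have h1 := (e.symm : A × B →L[ℝ] WithLp 2 (A × B)).le_opNorm (e x)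
      simp only [ContinuousLinearEquiv.coe_coe, ContinuousLinearEquiv.symm_apply_apply] at h1
      nlinarith [norm_nonneg (e.symm : A × B →L[ℝ] WithLp 2 (A × B)), norm_nonneg (e x)])
  have hp : G (e x) = e x := by
    have := congrArg e hx
    simpa using this
  set p := e x
  have hp1 : ‖p.1‖ ≤ ρ₁ := by
    rw [← hp]
    simp only [G, Prod.smul_fst, norm_smul, Real.norm_of_nonneg (hc0 p)]
    exact (mul_le_of_le_one_left (norm_nonneg _) (hc1 p)).trans (hF1 _ (hmem p))
  have hp2 : ‖p.2‖ ≤ ρ₂ := by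
    rw [← hp]
    simp only [G, Prod.smul_snd, norm_smul, Real.norm_of_nonneg (hc0 p)]
    exact (mul_le_of_le_one_left (norm_nonneg _) (hc1 p)).trans (hF2 _ (hmem p))
  have hpi : π p = p := Prod.ext (he1 _ hp1) (he2 _ hp2)
  refine ⟨p, by rw [← hpi]; exact hmem p, ?_⟩
  have : c p = 1 := by simp [c, hpi]
  simpa [G, this, hpi] using hp

theorem stmt0 {n m : ℕ}
    (U : Set (EuclideanSpace ℝ (Fin n))) (V : Set (EuclideanSpace ℝ (Fin m)))
    (hUc : IsCompact U) (hUconv : Convex ℝ U)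
    (hVc : IsCompact V) (hVconv : Convex ℝ V)
    (φ₁ : EuclideanSpace ℝ (Fin n) × EuclideanSpace ℝ (Fin m) → EuclideanSpace ℝ (Fin n))
    (φ₂ : EuclideanSpace ℝ (Fin n) × EuclideanSpace ℝ (Fin m) → EuclideanSpace ℝ (Fin m))
    (hcont : ContinuousOn (fun p => (φ₁ p, φ₂ p)) (U ×ˢ V))
    (ρ₁ ρ₂ : ℝ) (hρ₁ : 0 < ρ₁) (hρ₂ : 0 < ρ₂)
    (hb1 : ∀ p ∈ U ×ˢ V, ‖φ₁ p - p.1‖ ≤ ρ₁)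
    (hb2 : ∀ p ∈ U ×ˢ V, ‖φ₂ p - p.2‖ ≤ ρ₂)
    (α : EuclideanSpace ℝ (Fin n)) (β : EuclideanSpace ℝ (Fin m))
    (hα : α ∈ U) (hβ : β ∈ V)
    (hdα : ρ₁ ≤ infDist α (frontier U)) (hdβ : ρ₂ ≤ infDist β (frontier V)) :
    ∃ p ∈ U ×ˢ V, φ₁ p = α ∧ φ₂ p = β := by
  have hU := ball_aux U hUc.isClosed ρ₁ hρ₁ α hα hdα
  have hV := ball_aux V hVc.isClosed ρ₂ hρ₂ β hβ hdβ
  have hmem : ∀ q ∈ closedBall (0 : EuclideanSpace ℝ (Fin n)) ρ₁ ×ˢ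
      closedBall (0 : EuclideanSpace ℝ (Fin m)) ρ₂, q + (α, β) ∈ U ×ˢ V := by
    rintro q ⟨h1, h2⟩
    refine ⟨hU ?_, hV ?_⟩
    · simpa [dist_eq_norm] using h1
    · simpa [dist_eq_norm] using h2
  obtain ⟨q, hq, hfix⟩ := brouwer_prod ρ₁ ρ₂ hρ₁ hρ₂
    (fun q => (q + (α, β)) - (φ₁ (q + (α, β)), φ₂ (q + (α, β))))
    (by
      refine ContinuousOn.sub (by fun_prop) ?_
      exact hcont.comp (f := fun q => q + (α, β)) (by fun_prop) hmem)
    (fun q hq => by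
      have := hb1 _ (hmem q hq)
      rw [norm_sub_rev] at this
      exact this)
    (fun q hq => by
      have := hb2 _ (hmem q hq)
      rw [norm_sub_rev] at this
      exact this)
  refine ⟨q + (α, β), hmem q hq, ?_⟩
  have h := hfix
  rw [add_sub_assoc, add_eq_left, sub_eq_zero] at h
  exact ⟨(congrArg Prod.fst h).symm, (congrArg Prod.snd h).symm⟩
end

section
/- Let K̃ ⊂ ℝⁿ be compact, and for each small ε > 0 let m_ε : K̃ → ℝᵐ and h_ε : K̃ × [−δ,δ]ᵐ → ℝⁿ be continuous with ‖h_ε(x,λ) − x‖ ≤ C₁(ε) and ‖m_ε(h_ε(x,λ)) − m₀(h_ε(x,λ))‖ ≤ C₂(ε) on K̃ × [−δ,δ]ᵐ, where Cᵢ(ε) → 0 as ε → 0. Let K ⊂ Int K̃ be compact with dist(K, ∂K̃) > 0. Then there is ε₂ > 0 such that for all 0 < ε < ε₂, the set A_δ = {(x,y) : x ∈ K, ‖y − m₀(x)‖ ≤ δ/2} is contained in the image of the map T_ε(x,λ) = (h_ε(x,λ), λ + m_ε(h_ε(x,λ))). -/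
open Metric Set

lemma br_cov {n : ℕ} (g : (Fin n → ℝ) → (Fin n → ℝ)) (hg : ContDiff ℝ 1 g) (R : ℝ)
    (hR : ∀ x, R ≤ ‖x‖ → g x = 0) :
    ∃ τ > (0 : ℝ), ∀ t, 0 < t → t < τ → ∀ φ : (Fin n → ℝ) → ℝ,
      ∫ x in closedBall (0 : Fin n → ℝ) R,
        φ (x + t • g x) * (1 + t • fderiv ℝ g x : (Fin n → ℝ) →L[ℝ] (Fin n → ℝ)).det
        = ∫ x in closedBall (0 : Fin n → ℝ) R, φ x := by
  have hcs : HasCompactSupport g := by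
    apply HasCompactSupport.intro (isCompact_closedBall (0 : Fin n → ℝ) R)
    intro x hx
    apply hR
    rw [mem_closedBall_zero_iff] at hx
    exact (not_le.1 hx).le
  obtain ⟨K, hK⟩ := ContDiff.lipschitzWith_of_hasCompactSupport hcs hg one_ne_zero
  have hdet : ∃ η > (0 : ℝ), ∀ A : (Fin n → ℝ) →L[ℝ] (Fin n → ℝ), ‖A‖ < η → 0 < (1 + A).det := by
    have hc : Continuous fun A : (Fin n → ℝ) →L[ℝ] (Fin n → ℝ) => (1 + A).det :=
      ContinuousLinearMap.continuous_det.comp (continuous_const.add continuous_id)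
    have h0 : {A : (Fin n → ℝ) →L[ℝ] (Fin n → ℝ) | 0 < (1 + A).det} ∈ nhds 0 := by
      apply (isOpen_lt continuous_const hc).mem_nhds
      simp [ContinuousLinearMap.det]
    obtain ⟨η, hη, h⟩ := Metric.mem_nhds_iff.1 h0
    exact ⟨η, hη, fun A hA => h (by simpa using hA)⟩
  obtain ⟨η, hη, hdet⟩ := hdet
  refine ⟨min 1 η / (K + 1), by positivity, fun t ht htτ φ => ?_⟩
  have hK1 : (0 : ℝ) < K + 1 := by positivity
  rw [lt_div_iff₀ hK1] at htτ
  have htK1 : t * K < 1 := by nlinarith [min_le_left 1 η]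
  have htKη : t * K < η := by nlinarith [min_le_right 1 η]
  have hgl : ∀ x y, ‖g x - g y‖ ≤ K * ‖x - y‖ := fun x y => by
    simpa [dist_eq_norm] using hK.dist_le_mul x y
  have hinj : Function.Injective fun x => x + t • g x := by
    intro x y hxy
    have h1 : x - y = t • (g y - g x) := by
      simp only at hxy
      rw [smul_sub, sub_eq_sub_iff_add_eq_add, hxy, add_comm]
    have h2 : ‖x - y‖ ≤ t * K * ‖x - y‖ := by
      calc ‖x - y‖ = t * ‖g y - g x‖ := by
            conv_lhs => rw [h1, norm_smul, Real.norm_of_nonneg ht.le]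
        _ ≤ t * (K * ‖x - y‖) := by
            rw [norm_sub_rev]; exact mul_le_mul_of_nonneg_left (hgl x y) ht.le
        _ = _ := by ring
    have h3 : ‖x - y‖ = 0 := by nlinarith [norm_nonneg (x - y)]
    exact sub_eq_zero.1 (norm_eq_zero.1 h3)
  have hsurj : Function.Surjective fun x => x + t • g x := by
    intro y
    have hc : ContractingWith (t.toNNReal * K) fun x => y - t • g x := by
      refine ⟨?_, LipschitzWith.of_dist_le_mul fun a b => ?_⟩
      · rw [← NNReal.coe_lt_coe]; simpa [ht.le] using htK1
      · rw [dist_eq_norm, dist_eq_norm, sub_sub_sub_cancel_left, ← smul_sub, norm_smul,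
          Real.norm_of_nonneg ht.le, norm_sub_rev]
        have := mul_le_mul_of_nonneg_left (hgl a b) ht.le
        simpa [mul_assoc, ht.le] using this
    refine ⟨hc.fixedPoint, ?_⟩
    have := hc.fixedPoint_isFixedPt
    unfold Function.IsFixedPt at this
    simp only at this ⊢
    nth_rw 1 [← this]
    simp
  have himg : (fun x => x + t • g x) '' closedBall 0 R = closedBall 0 R := by
    ext y
    constructor
    · rintro ⟨x, hx, rfl⟩
      by_contra hy
      have hy' := hy
      rw [mem_closedBall_zero_iff, not_le] at hy
      have : (fun x => x + t • g x) (x + t • g x) = (fun x => x + t • g x) x := by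
        simp [hR _ hy.le]
      exact hy' (by simpa [hinj this] using hx)
    · intro hy
      obtain ⟨x, rfl⟩ := hsurj y
      refine ⟨x, ?_, rfl⟩
      by_contra hx
      have hx' := hx
      rw [mem_closedBall_zero_iff, not_le] at hx
      simp only [hR _ hx.le, smul_zero, add_zero] at hy
      exact hx' hy
  have hder : ∀ x ∈ closedBall (0 : Fin n → ℝ) R, HasFDerivWithinAt (fun x => x + t • g x)
      (1 + t • fderiv ℝ g x : (Fin n → ℝ) →L[ℝ] (Fin n → ℝ)) (closedBall 0 R) x := by
    intro x _
    have h1 : HasFDerivAt g (fderiv ℝ g x) x := (hg.differentiable one_ne_zero x).hasFDerivAt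
    exact ((hasFDerivAt_id x).add (h1.const_smul t)).hasFDerivWithinAt
  have key := MeasureTheory.integral_image_eq_integral_abs_det_fderiv_smul MeasureTheory.volume
    (measurableSet_closedBall) hder hinj.injOn φ
  rw [himg] at key
  rw [key]
  apply MeasureTheory.integral_congr_ae
  filter_upwards with x
  have hp : 0 < (1 + t • fderiv ℝ g x : (Fin n → ℝ) →L[ℝ] (Fin n → ℝ)).det := by
    apply hdet
    rw [norm_smul, Real.norm_of_nonneg ht.le]
    have := norm_fderiv_le_of_lipschitz ℝ hK (x₀ := x)
    nlinarith
  rw [abs_of_pos hp, smul_eq_mul, mul_comm]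

open Polynomial in
lemma br_poly {n : ℕ} (x v : Fin n → ℝ) (A : (Fin n → ℝ) →L[ℝ] (Fin n → ℝ)) (M : ℝ) (k : ℕ) :
    ∃ q : ℝ[X], q.natDegree ≤ 2 * k + n ∧ ∀ t : ℝ, q.eval t =
      (1 - (∑ i, (x + t • v) i ^ 2) / M) ^ k * (1 + t • A).det := by
  let a := LinearMap.toMatrix' (A : (Fin n → ℝ) →ₗ[ℝ] (Fin n → ℝ))
  refine ⟨(1 - C M⁻¹ * ∑ i, (C (x i) + X * C (v i)) ^ 2) ^ k *
    Matrix.det ((X : ℝ[X]) • a.map C + (1 : Matrix (Fin n) (Fin n) ℝ).map C), ?_, ?_⟩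
  · refine natDegree_mul_le.trans (add_le_add ?_ ?_)
    · refine natDegree_pow_le.trans ?_
      rw [mul_comm]
      refine Nat.mul_le_mul_right _ ?_
      refine (natDegree_sub_le _ _).trans ?_
      simp only [natDegree_one, zero_le, sup_of_le_right]
      refine (natDegree_C_mul_le _ _).trans ?_
      refine natDegree_sum_le_of_forall_le _ _ fun i _ => ?_
      compute_degree
    · simpa using natDegree_det_X_add_C_le a 1
  · intro t
    rw [eval_mul, eval_pow]
    congr 1
    · simp only [eval_finsetSum, eval_sub, eval_one, eval_mul, eval_C, eval_pow, eval_add, eval_X,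
        Pi.add_apply, Pi.smul_apply, smul_eq_mul]
      ring
    · rw [← coe_evalRingHom, RingHom.map_det, ContinuousLinearMap.det, ← LinearMap.det_toMatrix']
      congr 1
      ext i j
      simp [a, Matrix.one_apply, LinearMap.toMatrix'_apply, Pi.single_apply]
      split_ifs <;> simp [add_comm, mul_comm]

lemma br_int {n : ℕ} (g : (Fin n → ℝ) → (Fin n → ℝ)) (hg : ContDiff ℝ 1 g) (R : ℝ)
    (hR : ∀ x, R ≤ ‖x‖ → g x = 0) (M : ℝ) (k : ℕ) :
      ∫ x in closedBall (0 : Fin n → ℝ) R,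
        (1 - (∑ i, (x + g x) i ^ 2) / M) ^ k *
          (1 + fderiv ℝ g x : (Fin n → ℝ) →L[ℝ] (Fin n → ℝ)).det
        = ∫ x in closedBall (0 : Fin n → ℝ) R, (1 - (∑ i, x i ^ 2) / M) ^ k := by
  obtain ⟨τ, hτ, hcov⟩ := br_cov g hg R hR
  set s := Finset.range (2 * k + n + 1) with hs
  set v : ℕ → ℝ := fun i => τ / (i + 2) with hv
  have hvpos : ∀ i, 0 < v i := fun i => by simp only [hv]; positivity
  have hvlt : ∀ i, v i < τ := fun i => by
    simp only [hv]
    rw [div_lt_iff₀ (by positivity)]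
    nlinarith [(Nat.cast_nonneg i : (0 : ℝ) ≤ i)]
  have hvinj : Set.InjOn v s := by
    intro i _ j _ h
    simp only [hv] at h
    rw [div_eq_div_iff (by positivity) (by positivity)] at h
    have := mul_left_cancel₀ hτ.ne' h
    have h2 : (j : ℝ) = i := by linarith
    exact_mod_cast h2.symm
  set Q : ℝ → (Fin n → ℝ) → ℝ := fun t x => (1 - (∑ i, (x + t • g x) i ^ 2) / M) ^ k *
    (1 + t • fderiv ℝ g x : (Fin n → ℝ) →L[ℝ] (Fin n → ℝ)).det with hQ
  have hfc : Continuous (fderiv ℝ g) := hg.continuous_fderiv one_ne_zero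
  have hgc : Continuous g := hg.continuous
  have hQc : ∀ t, Continuous (Q t) := by
    intro t
    simp only [hQ]
    refine Continuous.mul (by fun_prop) ?_
    exact ContinuousLinearMap.continuous_det.comp (continuous_const.add (hfc.const_smul t))
  have hQi : ∀ t, MeasureTheory.IntegrableOn (Q t) (closedBall (0 : Fin n → ℝ) R) := fun t =>
    (hQc t).continuousOn.integrableOn_compact (isCompact_closedBall _ _)
  have hint : ∀ x, Q 1 x = ∑ i ∈ s, Q (v i) x * (Lagrange.basis s v i).eval 1 := by
    intro x
    obtain ⟨q, hq, hqe⟩ := br_poly x (g x) (fderiv ℝ g x) M k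
    have hd : q.degree < s.card := by
      refine (Polynomial.degree_le_natDegree).trans_lt ?_
      rw [hs, Finset.card_range]
      exact_mod_cast Nat.lt_succ_of_le hq
    have h1 := congrArg (Polynomial.eval 1) (Lagrange.eq_interpolate hvinj hd)
    rw [Lagrange.interpolate_apply, Polynomial.eval_finsetSum] at h1
    simp only [Polynomial.eval_mul, Polynomial.eval_C] at h1
    simp only [hqe] at h1
    exact h1
  have hb : ∑ i ∈ s, (Lagrange.basis s v i).eval 1 = (1 : ℝ) := by
    rw [← Polynomial.eval_finsetSum, Lagrange.sum_basis hvinj ⟨0, by simp [hs]⟩]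
    simp
  have h2 : ∫ x in closedBall (0 : Fin n → ℝ) R, Q 1 x
      = ∫ x in closedBall (0 : Fin n → ℝ) R, (1 - (∑ i, x i ^ 2) / M) ^ k := by
    simp_rw [hint]
    rw [MeasureTheory.integral_finsetSum _ fun i _ => (hQi (v i)).mul_const _]
    simp_rw [MeasureTheory.integral_mul_const]
    have : ∀ i, ∫ x in closedBall (0 : Fin n → ℝ) R, Q (v i) x
      = ∫ x in closedBall (0 : Fin n → ℝ) R, (1 - (∑ i, x i ^ 2) / M) ^ k := fun i =>
      hcov (v i) (hvpos i) (hvlt i) (fun y => (1 - (∑ i, y i ^ 2) / M) ^ k)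
    simp_rw [this]
    rw [← Finset.mul_sum, hb, mul_one]
  simpa [hQ] using h2

lemma br_zero {n : ℕ} (g : (Fin n → ℝ) → (Fin n → ℝ)) (hg : ContDiff ℝ 1 g) (R : ℝ) (hRpos : 0 < R)
    (hR : ∀ x, R ≤ ‖x‖ → g x = 0) : ∃ x, x + g x = 0 := by
  by_contra! hne
  set B := closedBall (0 : Fin n → ℝ) R with hB
  have hBc : IsCompact B := isCompact_closedBall _ _
  have hfc : Continuous (fderiv ℝ g) := hg.continuous_fderiv one_ne_zero
  have hgc : Continuous g := hg.continuous
  set N : (Fin n → ℝ) → ℝ := fun x => ∑ i, x i ^ 2 with hN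
  have hNc : Continuous N := by simp only [hN]; fun_prop
  have hNnn : ∀ x, 0 ≤ N x := fun x => Finset.sum_nonneg fun i _ => sq_nonneg _
  have hNpos : ∀ x, x ≠ 0 → 0 < N x := by
    intro x hx
    refine lt_of_le_of_ne (hNnn x) fun h => hx ?_
    have := (Finset.sum_eq_zero_iff_of_nonneg (fun i _ => sq_nonneg (x i))).1 h.symm
    ext i
    simpa using this i (Finset.mem_univ i)
  have hNgc : Continuous fun x => N (x + g x) := hNc.comp (continuous_id.add hgc)
  have h0B : (0 : Fin n → ℝ) ∈ B := by simp [hB, hRpos.le]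
  obtain ⟨x₀, hx₀, hmin⟩ := hBc.exists_isMinOn ⟨0, h0B⟩ hNgc.continuousOn
  set a := N (x₀ + g x₀) with ha
  have hapos : 0 < a := hNpos _ (hne x₀)
  have hmin' : ∀ x ∈ B, a ≤ N (x + g x) := fun x hx => hmin hx
  obtain ⟨M₁, hM₁⟩ := hBc.bddAbove_image hNgc.continuousOn
  obtain ⟨M₂, hM₂⟩ := hBc.bddAbove_image hNc.continuousOn
  set M := max M₁ M₂ with hM
  have hM1 : ∀ x ∈ B, N (x + g x) ≤ M := fun x hx =>
    (hM₁ (mem_image_of_mem (fun x => N (x + g x)) hx)).trans (le_max_left _ _)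
  have hM2 : ∀ x ∈ B, N x ≤ M := fun x hx =>
    (hM₂ (mem_image_of_mem _ hx)).trans (le_max_right _ _)
  have haM : a ≤ M := hM1 x₀ hx₀
  have hMpos : 0 < M := hapos.trans_le haM
  set α := 1 - a / M with hα
  set β := 1 - (a / 2) / M with hβ
  have hα0 : 0 ≤ α := by rw [hα, sub_nonneg, div_le_one hMpos]; exact haM
  have hαβ : α < β := by
    rw [hα, hβ]
    have : a / 2 / M < a / M := by gcongr; linarith
    linarith
  have hβ0 : 0 < β := hα0.trans_lt hαβ
  set D : (Fin n → ℝ) → ℝ := fun x => (1 + fderiv ℝ g x : (Fin n → ℝ) →L[ℝ] (Fin n → ℝ)).det with hD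
  have hDc : Continuous D :=
    ContinuousLinearMap.continuous_det.comp (continuous_const.add hfc)
  set I := ∫ x in B, |D x| with hI
  set U := ball (0 : Fin n → ℝ) R ∩ {x | N x < a / 2} with hU
  have hUo : IsOpen U := isOpen_ball.inter (isOpen_lt hNc continuous_const)
  have hU0 : (0 : Fin n → ℝ) ∈ U := by
    refine ⟨by simp [hRpos], ?_⟩
    simp [hN, hapos]
  have hUB : U ⊆ B := inter_subset_left.trans ball_subset_closedBall
  have hUfin : MeasureTheory.volume U ≠ ⊤ :=
    ((MeasureTheory.measure_mono hUB).trans_lt hBc.measure_lt_top).ne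
  set V := MeasureTheory.volume.real U with hV
  have hVpos : 0 < V := ENNReal.toReal_pos (hUo.measure_pos _ ⟨0, hU0⟩).ne' hUfin
  have hmain : ∀ k : ℕ, V * β ^ k ≤ I * α ^ k := by
    intro k
    have h1 := br_int g hg R hR M k
    have hi1 : MeasureTheory.IntegrableOn (fun x => (1 - N x / M) ^ k) B := by
      refine Continuous.continuousOn (by fun_prop) |>.integrableOn_compact hBc
    have hi2 : MeasureTheory.IntegrableOn (fun x => (1 - N (x + g x) / M) ^ k * D x) B := by
      refine Continuous.continuousOn (by fun_prop) |>.integrableOn_compact hBc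
    have hi3 : MeasureTheory.IntegrableOn (fun x => |D x|) B := by
      refine Continuous.continuousOn (by fun_prop) |>.integrableOn_compact hBc
    calc V * β ^ k = ∫ x in U, β ^ k := by simp [hV]
      _ ≤ ∫ x in U, (1 - N x / M) ^ k := by
          apply MeasureTheory.setIntegral_mono_on _ (hi1.mono_set hUB) hUo.measurableSet
          · intro x hx
            have : N x < a / 2 := hx.2
            apply pow_le_pow_left₀ hβ0.le
            rw [hβ]
            gcongr
          · exact MeasureTheory.integrableOn_const hUfin
      _ ≤ ∫ x in B, (1 - N x / M) ^ k := by
          apply MeasureTheory.setIntegral_mono_set hi1 _ (Filter.Eventually.of_forall hUB)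
          apply (MeasureTheory.ae_restrict_iff' measurableSet_closedBall).2
          filter_upwards with x hx
          apply pow_nonneg
          rw [sub_nonneg, div_le_one hMpos]
          exact hM2 x hx
      _ = ∫ x in B, (1 - N (x + g x) / M) ^ k * D x := h1.symm
      _ ≤ ∫ x in B, |D x| * α ^ k := by
          apply MeasureTheory.setIntegral_mono_on hi2 (hi3.mul_const _) measurableSet_closedBall
          intro x hx
          rw [mul_comm]
          have hnn : 0 ≤ 1 - N (x + g x) / M := by
            rw [sub_nonneg, div_le_one hMpos]
            exact hM1 x hx
          refine mul_le_mul (le_abs_self _) ?_ (pow_nonneg hnn _) (abs_nonneg _)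
          apply pow_le_pow_left₀ hnn
          rw [hα]
          have := hmin' x hx
          gcongr
      _ = I * α ^ k := by rw [MeasureTheory.integral_mul_const]
  have hlim : Filter.Tendsto (fun k : ℕ => I * (α / β) ^ k) Filter.atTop (nhds (I * 0)) :=
    (tendsto_pow_atTop_nhds_zero_of_lt_one (by positivity) ((div_lt_one hβ0).2 hαβ)).const_mul I
  have hle : V ≤ I * 0 := by
    refine ge_of_tendsto' hlim fun k => ?_
    rw [div_pow, ← mul_div_assoc, le_div_iff₀ (by positivity)]
    exact hmain k
  linarith

open scoped Manifold in
lemma br_cont {n : ℕ} (u : (Fin n → ℝ) → (Fin n → ℝ)) (r r' : ℝ) (hr : 0 < r) (hrr : r' < r)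
    (hu : ContinuousOn u (closedBall 0 r)) (hb : ∀ x ∈ closedBall 0 r, ‖u x‖ ≤ r') :
    ∃ x ∈ closedBall (0 : Fin n → ℝ) r, x + u x = 0 := by
  by_contra! hne
  have hfc : ContinuousOn (fun x => ‖x + u x‖) (closedBall 0 r) := (continuousOn_id.add hu).norm
  obtain ⟨x₀, hx₀, hmin⟩ := (isCompact_closedBall (0 : Fin n → ℝ) r).exists_isMinOn
    ⟨0, by simp [hr.le]⟩ hfc
  set η := min ‖x₀ + u x₀‖ (r - r') with hη
  have hηpos : 0 < η := lt_min (norm_pos_iff.2 (hne x₀ hx₀)) (by linarith)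
  let c : (Fin n → ℝ) → (Fin n → ℝ) := fun x i => max (-r) (min r (x i))
  have hcc : Continuous c := by fun_prop
  have hcB : ∀ x, c x ∈ closedBall (0 : Fin n → ℝ) r := by
    intro x
    rw [mem_closedBall_zero_iff, pi_norm_le_iff_of_nonneg hr.le]
    intro i
    rw [Real.norm_eq_abs, abs_le]
    exact ⟨le_max_left _ _, max_le (by linarith) (min_le_left _ _)⟩
  have hcid : ∀ x ∈ closedBall (0 : Fin n → ℝ) r, c x = x := by
    intro x hx
    rw [mem_closedBall_zero_iff, pi_norm_le_iff_of_nonneg hr.le] at hx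
    ext i
    have := hx i
    rw [Real.norm_eq_abs, abs_le] at this
    simp only [c]
    rw [min_eq_right this.2, max_eq_right this.1]
  let χ : (Fin n → ℝ) → ℝ := fun x => max 0 (min 1 (2 - ‖x‖ / r))
  have hχc : Continuous χ := by fun_prop
  have hχ0 : ∀ x, 0 ≤ χ x := fun x => le_max_left _ _
  have hχ1 : ∀ x, χ x ≤ 1 := fun x => max_le zero_le_one (min_le_left _ _)
  have hχB : ∀ x ∈ closedBall (0 : Fin n → ℝ) r, χ x = 1 := by
    intro x hx
    rw [mem_closedBall_zero_iff] at hx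
    have : ‖x‖ / r ≤ 1 := (div_le_one hr).2 hx
    simp only [χ]
    rw [min_eq_left (by linarith), max_eq_right zero_le_one]
  have hχ2 : ∀ x, 2 * r ≤ ‖x‖ → χ x = 0 := by
    intro x hx
    have : 2 ≤ ‖x‖ / r := (le_div_iff₀ hr).2 hx
    simp only [χ]
    exact max_eq_left ((min_le_right _ _).trans (by linarith))
  let w : (Fin n → ℝ) → (Fin n → ℝ) := fun x => χ x • u (c x)
  have hwc : Continuous w := hχc.smul (hu.comp_continuous hcc hcB)
  have hwη : ∀ x, η ≤ ‖x + w x‖ := by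
    intro x
    by_cases hx : x ∈ closedBall (0 : Fin n → ℝ) r
    · simp only [w]
      rw [hχB x hx, hcid x hx, one_smul]
      exact (min_le_left _ _).trans (hmin hx)
    · rw [mem_closedBall_zero_iff, not_le] at hx
      have h1 : ‖w x‖ ≤ r' := by
        simp only [w]
        rw [norm_smul, Real.norm_of_nonneg (hχ0 x)]
        have := hb _ (hcB x)
        nlinarith [hχ1 x, norm_nonneg (u (c x)), hχ0 x]
      have h2 : ‖x‖ ≤ ‖x + w x‖ + ‖w x‖ := by
        simpa using norm_sub_le (x + w x) (w x)
      have := min_le_right ‖x₀ + u x₀‖ (r - r')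
      linarith
  classical
  let T : (Fin n → ℝ) → Set (Fin n → ℝ) := fun x =>
    if ‖x‖ < 3 * r then ball (w x) η else {0}
  obtain ⟨g, hg⟩ := exists_contMDiffMap_forall_mem_convex_of_local_const (n := 1) (t := T)
    𝓘(ℝ, Fin n → ℝ) (fun x => by
      simp only [T]; split_ifs
      · exact convex_ball _ _
      · exact convex_singleton _) (fun x => by
      by_cases hx : ‖x‖ < 3 * r
      · refine ⟨w x, ?_⟩
        have h1 : ∀ᶠ y in nhds x, ‖y‖ < 3 * r :=
          (isOpen_lt continuous_norm continuous_const).mem_nhds hx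
        have h2 : ∀ᶠ y in nhds x, dist (w y) (w x) < η :=
          hwc.continuousAt.eventually (Metric.ball_mem_nhds _ hηpos)
        filter_upwards [h1, h2] with y hy1 hy2
        simp only [T, if_pos hy1]
        rwa [mem_ball, dist_comm]
      · refine ⟨0, ?_⟩
        have h1 : ∀ᶠ y in nhds x, 2 * r < ‖y‖ :=
          (isOpen_lt continuous_const continuous_norm).mem_nhds (by
            rw [mem_ofPred_eq]; linarith)
        filter_upwards [h1] with y hy1
        simp only [T]
        split_ifs
        · have : w y = 0 := by simp [w, hχ2 y hy1.le]
          simp [this, hηpos]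
        · simp)
  obtain ⟨x, hx⟩ := br_zero g g.contMDiff.contDiff (3 * r) (by linarith) (fun x hx => by
    have := hg x
    simpa [T, not_lt.2 hx] using this)
  have hgx := hg x
  have hd : ‖g x - w x‖ < η := by
    simp only [T] at hgx
    split_ifs at hgx with h
    · simpa [dist_eq_norm] using hgx
    · have : w x = 0 := by simp [w, hχ2 x (by linarith)]
      rw [mem_singleton_iff] at hgx
      simp [this, hgx, hηpos]
  have h3 : x + w x = -(g x - w x) := by
    have h4 : x + w x = (x + g x) - (g x - w x) := by abel
    rw [h4, hx, zero_sub]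
  have := hwη x
  rw [h3, norm_neg] at this
  linarith

theorem stmt19 {n m : ℕ}
    (Kt : Set (Fin n → ℝ)) (hKt : IsCompact Kt) (hKtconv : Convex ℝ Kt)
    (δ : ℝ) (hδ : 0 < δ)
    (m₀ : (Fin n → ℝ) → (Fin m → ℝ)) (hm₀ : ContinuousOn m₀ Kt)
    (ε₁ : ℝ) (hε₁ : 0 < ε₁)
    (mE : ℝ → (Fin n → ℝ) → (Fin m → ℝ))
    (hE : ℝ → (Fin n → ℝ) × (Fin m → ℝ) → (Fin n → ℝ))
    (hmEcont : ∀ ε ∈ Ioo (0 : ℝ) ε₁, ContinuousOn (mE ε) Kt)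
    (hhEcont : ∀ ε ∈ Ioo (0 : ℝ) ε₁,
      ContinuousOn (hE ε) (Kt ×ˢ {l : Fin m → ℝ | ∀ i, |l i| ≤ δ}))
    (C₁ C₂ : ℝ → ℝ)
    (hC₁ : Filter.Tendsto C₁ (nhdsWithin 0 (Ioi 0)) (nhds 0))
    (hC₂ : Filter.Tendsto C₂ (nhdsWithin 0 (Ioi 0)) (nhds 0))
    (hb₁ : ∀ ε ∈ Ioo (0 : ℝ) ε₁, ∀ x ∈ Kt, ∀ l : Fin m → ℝ, (∀ i, |l i| ≤ δ) →
      ‖hE ε (x, l) - x‖ ≤ C₁ ε)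
    (hb₂ : ∀ ε ∈ Ioo (0 : ℝ) ε₁, ∀ x ∈ Kt, ∀ l : Fin m → ℝ, (∀ i, |l i| ≤ δ) →
      ‖mE ε (hE ε (x, l)) - m₀ (hE ε (x, l))‖ ≤ C₂ ε)
    (K : Set (Fin n → ℝ)) (hK : IsCompact K) (hKint : K ⊆ interior Kt)
    (ρ : ℝ) (hρ : 0 < ρ) (hKd : ∀ x ∈ K, ρ ≤ infDist x (frontier Kt)) :
    ∃ ε₂ > (0 : ℝ), ∀ ε, 0 < ε → ε < ε₂ →
      ∀ p : (Fin n → ℝ) × (Fin m → ℝ), p.1 ∈ K → ‖p.2 - m₀ p.1‖ ≤ δ / 2 →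
        ∃ x ∈ Kt, ∃ l : Fin m → ℝ, (∀ i, |l i| ≤ δ) ∧
          (hE ε (x, l), l + mE ε (hE ε (x, l))) = p := by
  obtain ⟨r, hr, hrK⟩ := hK.exists_cthickening_subset_open isOpen_interior hKint
  have hball : ∀ p ∈ K, closedBall p r ⊆ Kt := fun p hp =>
    (closedBall_subset_cthickening hp r).trans (hrK.trans interior_subset)
  have e1 : ∀ᶠ ε in nhdsWithin (0 : ℝ) (Ioi 0), C₁ ε < r := hC₁.eventually (gt_mem_nhds hr)
  have e2 : ∀ᶠ ε in nhdsWithin (0 : ℝ) (Ioi 0), C₂ ε < δ / 2 :=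
    hC₂.eventually (gt_mem_nhds (half_pos hδ))
  obtain ⟨ε₃, hε₃, hε₃'⟩ := mem_nhdsGT_iff_exists_Ioo_subset.1 (e1.and e2)
  refine ⟨min ε₁ ε₃, lt_min hε₁ hε₃, fun ε hε hlt p hp hp2 => ?_⟩
  have hεm : ε ∈ Ioo (0 : ℝ) ε₁ := ⟨hε, hlt.trans_le (min_le_left _ _)⟩
  obtain ⟨hc1, hc2⟩ : C₁ ε < r ∧ C₂ ε < δ / 2 := hε₃' ⟨hε, hlt.trans_le (min_le_right _ _)⟩
  have hsol : ∀ l : Fin m → ℝ, (∀ i, |l i| ≤ δ) → ∃ x ∈ Kt, hE ε (x, l) = p.1 := by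
    intro l hl
    have hmem : ∀ z ∈ closedBall (0 : Fin n → ℝ) r, p.1 + z ∈ Kt := fun z hz =>
      hball p.1 hp (by simpa [dist_eq_norm] using hz)
    obtain ⟨z, hz, hz0⟩ := br_cont (fun z => hE ε (p.1 + z, l) - (p.1 + z)) r (C₁ ε) hr hc1
      (by
        refine ContinuousOn.sub ?_ (by fun_prop)
        exact (hhEcont ε hεm).comp (f := fun z => (p.1 + z, l)) (by fun_prop)
          fun z hz => ⟨hmem z hz, hl⟩)
      (fun z hz => hb₁ ε hεm _ (hmem z hz) l hl)
    refine ⟨p.1 + z, hmem z hz, ?_⟩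
    have h4 : z + (hE ε (p.1 + z, l) - (p.1 + z)) = hE ε (p.1 + z, l) - p.1 := by abel
    rw [h4] at hz0
    exact sub_eq_zero.1 hz0
  have h0 : ∀ i, |(0 : Fin m → ℝ) i| ≤ δ := fun i => by simp [hδ.le]
  obtain ⟨x₀, hx₀, hx₀p⟩ := hsol 0 h0
  have hm := hb₂ ε hεm x₀ hx₀ 0 h0
  rw [hx₀p] at hm
  have hl : ∀ i, |(p.2 - mE ε p.1) i| ≤ δ := by
    intro i
    have h1 : ‖p.2 - mE ε p.1‖ ≤ δ := by
      have h2 : p.2 - mE ε p.1 = (p.2 - m₀ p.1) - (mE ε p.1 - m₀ p.1) := by abel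
      rw [h2]
      exact (norm_sub_le _ _).trans (by linarith)
    exact (norm_le_pi_norm (p.2 - mE ε p.1) i).trans h1
  obtain ⟨x, hx, hxp⟩ := hsol _ hl
  refine ⟨x, hx, _, hl, ?_⟩
  rw [hxp]
  simp
end
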